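/- arXiv:2504.06967 — 7 statements merged into one kernel-verified Lean document; each statement's English description precedes it below -/
import Mathlib

section
/- Let T ∈ (0,∞), let s_p, s_q : [0,T] → [0,∞) be continuous, let f : [0,T] → [0,1] be continuously differentiable with f′(t) = (1−f)(p₀ + b_p√s_p(t) + (q₀ + b_q√s_q(t)) f) and f(0) = 0, and let Ψ : [0,T] → ℝ be continuously differentiable with Ψ′(t) = (γe^{−θt} + Ψ)(p₀ + b_p√s_p(t) + (q₀ + b_q√s_q(t))(2f−1)) and Ψ(T) = 0. Suppose there exists t̃ ∈ [0,T] with f(t̃) = 1/2. Then −γe^{−θt} ≤ Ψ(t) ≤ 0 for all t ∈ [t̃, T]. -/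
/-- Bounds on the costate: for the Bass adoption equation on an infinite complete network
under nonnegative continuous promotion spending rates `s_p, s_q`, with adjoint variable `Ψ`
satisfying `Ψ(T) = 0`, if `f(t̃) = 1/2` then `-γ e^{-θt} ≤ Ψ(t) ≤ 0` on `[t̃, T]`. -/
theorem stmt8 (p₀ q₀ bp bq γ θ : ℝ)
    (hp₀ : 0 < p₀) (hq₀ : 0 < q₀) (hbp : 0 < bp) (hbq : 0 < bq) (hγ : 0 < γ) (hθ : 0 < θ)
    (T : ℝ) (hT : 0 < T)
    (sp sq f Ψ : ℝ → ℝ)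
    (hsp_cont : ContinuousOn sp (Set.Icc 0 T))
    (hsq_cont : ContinuousOn sq (Set.Icc 0 T))
    (hsp_nonneg : ∀ t ∈ Set.Icc (0 : ℝ) T, 0 ≤ sp t)
    (hsq_nonneg : ∀ t ∈ Set.Icc (0 : ℝ) T, 0 ≤ sq t)
    (hf01 : ∀ t ∈ Set.Icc (0 : ℝ) T, f t ∈ Set.Icc (0 : ℝ) 1)
    (hf0 : f 0 = 0)
    (hf' : ∀ t ∈ Set.Icc (0 : ℝ) T, HasDerivAt f
      ((1 - f t) * (p₀ + bp * Real.sqrt (sp t) + (q₀ + bq * Real.sqrt (sq t)) * f t)) t)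
    (hΨ' : ∀ t ∈ Set.Icc (0 : ℝ) T, HasDerivAt Ψ
      ((γ * Real.exp (-θ * t) + Ψ t) *
        (p₀ + bp * Real.sqrt (sp t) + (q₀ + bq * Real.sqrt (sq t)) * (2 * f t - 1))) t)
    (hΨT : Ψ T = 0)
    (t₀ : ℝ) (ht₀ : t₀ ∈ Set.Icc (0 : ℝ) T) (hf_half : f t₀ = 1 / 2) :
    ∀ t ∈ Set.Icc t₀ T, -γ * Real.exp (-θ * t) ≤ Ψ t ∧ Ψ t ≤ 0 := by
  have hmono : MonotoneOn f (Set.Icc 0 T) := by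
    refine monotoneOn_of_hasDerivWithinAt_nonneg (convex_Icc 0 T)
      (fun x hx => (hf' x hx).continuousAt.continuousWithinAt)
      (fun x hx => (hf' x (interior_subset hx)).hasDerivWithinAt) ?_
    intro x hx
    have hx' := interior_subset hx
    have h1 := (hf01 x hx').1
    have h2 : 0 ≤ 1 - f x := by linarith [(hf01 x hx').2]
    positivity
  have hu' : ∀ t ∈ Set.Icc (0 : ℝ) T, HasDerivAt (fun t => γ * Real.exp (-θ * t) + Ψ t)
      (γ * (Real.exp (-θ * t) * (-θ * 1)) + (γ * Real.exp (-θ * t) + Ψ t) *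
        (p₀ + bp * Real.sqrt (sp t) + (q₀ + bq * Real.sqrt (sq t)) * (2 * f t - 1))) t := by
    intro t ht
    exact ((((hasDerivAt_id' t).const_mul (-θ)).exp).const_mul γ).add (hΨ' t ht)
  have hu : ∀ t ∈ Set.Icc (0 : ℝ) T, 0 ≤ γ * Real.exp (-θ * t) + Ψ t := by
    intro a ha
    by_contra hneg
    push Not at hneg
    have hsub : ∀ x ∈ Set.Icc a T, x ∈ Set.Icc (0 : ℝ) T :=
      fun x hx => ⟨ha.1.trans hx.1, hx.2⟩
    have key := image_le_of_deriv_right_lt_deriv_boundary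
      (f := fun t => γ * Real.exp (-θ * t) + Ψ t) (a := a) (b := T)
      (B := fun _ => (0 : ℝ)) (B' := fun _ => (0 : ℝ))
      (fun x hx => (hu' x (hsub x hx)).continuousAt.continuousWithinAt)
      (fun x hx => (hu' x (hsub x ⟨hx.1, hx.2.le⟩)).hasDerivWithinAt)
      hneg.le (fun x => hasDerivAt_const x (0 : ℝ))
      (by
        intro x hx h0
        rw [h0]
        have : 0 < γ * (Real.exp (-θ * x) * θ) := by positivity
        linarith)
      (Set.right_mem_Icc.2 ha.2)
    simp only [hΨT] at key
    have : 0 < γ * Real.exp (-θ * T) := by positivity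
    linarith
  have hsub : ∀ x ∈ Set.Icc t₀ T, x ∈ Set.Icc (0 : ℝ) T :=
    fun x hx => ⟨ht₀.1.trans hx.1, hx.2⟩
  have hΨmono : MonotoneOn Ψ (Set.Icc t₀ T) := by
    refine monotoneOn_of_hasDerivWithinAt_nonneg (convex_Icc t₀ T)
      (fun x hx => (hΨ' x (hsub x hx)).continuousAt.continuousWithinAt)
      (fun x hx => (hΨ' x (hsub x (interior_subset hx))).hasDerivWithinAt) ?_
    intro x hx
    have hx1 : x ∈ Set.Icc t₀ T := interior_subset hx
    have h1 := hu x (hsub x hx1)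
    have h2 := hmono ht₀ (hsub x hx1) hx1.1
    have h3 : 0 ≤ 2 * f x - 1 := by linarith
    exact mul_nonneg h1 (by positivity)
  intro t ht
  have h1 := hu t (hsub t ht)
  have h2 := hΨmono ht (Set.right_mem_Icc.2 ht₀.2) ht.2
  exact ⟨by linarith, by linarith⟩
end

section
/- Let 0 < T < ∞, let f, Ψ : [0,T] → ℝ be continuously differentiable with f(t) ∈ [0,1] for all t, f(0) = 0, Ψ(T) = 0, satisfying f′ = (1−f)(p₀ + b_p√s_p + (q₀ + b_q√s_q) f) and Ψ′ = (γe^{−θt} + Ψ)(p₀ + b_p√s_p + (q₀ + b_q√s_q)(2f−1)), where s_p(t) := (b_p²/4)((1−f)(Ψe^{θt} + γ))² and s_q(t) := (b_q²/b_p²) f² s_p. Then f(T) < 1, and at the end of the planning horizon s_p(T) = (b_p² γ²/4)(1−f(T))² > 0 and s_q(T) = (b_q² γ²/4) f(T)² (1−f(T))² > 0. -/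
/-- For the optimal-promotion boundary-value problem on an infinite complete network with a
finite planning horizon `T`, full adoption is not reached at `t = T`, and both optimal
spending rates remain strictly positive at the end of the planning horizon. -/
theorem stmt9 (p₀ q₀ bp bq γ θ : ℝ)
    (hp₀ : 0 < p₀) (hq₀ : 0 < q₀) (hbp : 0 < bp) (hbq : 0 < bq) (hγ : 0 < γ) (hθ : 0 < θ)
    (T : ℝ) (hT : 0 < T)
    (f Ψ sp sq : ℝ → ℝ)
    (hspdef : ∀ t : ℝ, sp t =
      bp ^ 2 / 4 * ((1 - f t) * (Ψ t * Real.exp (θ * t) + γ)) ^ 2)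
    (hsqdef : ∀ t : ℝ, sq t = bq ^ 2 / bp ^ 2 * (f t) ^ 2 * sp t)
    (hf01 : ∀ t ∈ Set.Icc (0 : ℝ) T, f t ∈ Set.Icc (0 : ℝ) 1)
    (hf0 : f 0 = 0) (hΨT : Ψ T = 0)
    (hf' : ∀ t ∈ Set.Icc (0 : ℝ) T, HasDerivAt f
      ((1 - f t) * (p₀ + bp * Real.sqrt (sp t) + (q₀ + bq * Real.sqrt (sq t)) * f t)) t)
    (hΨ' : ∀ t ∈ Set.Icc (0 : ℝ) T, HasDerivAt Ψ
      ((γ * Real.exp (-θ * t) + Ψ t) *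
        (p₀ + bp * Real.sqrt (sp t) + (q₀ + bq * Real.sqrt (sq t)) * (2 * f t - 1))) t) :
    f T < 1 ∧
      sp T = bp ^ 2 * γ ^ 2 / 4 * (1 - f T) ^ 2 ∧ 0 < sp T ∧
      sq T = bq ^ 2 * γ ^ 2 / 4 * (f T) ^ 2 * (1 - f T) ^ 2 ∧ 0 < sq T := by
  have hfc : ContinuousOn f (Set.Icc 0 T) := fun t ht => (hf' t ht).continuousAt.continuousWithinAt
  have hΨc : ContinuousOn Ψ (Set.Icc 0 T) := fun t ht => (hΨ' t ht).continuousAt.continuousWithinAt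
  have hspc : ContinuousOn sp (Set.Icc 0 T) := by
    rw [show sp = _ from funext hspdef]
    fun_prop
  have hsqc : ContinuousOn sq (Set.Icc 0 T) := by
    rw [show sq = _ from funext hsqdef]
    fun_prop
  set h : ℝ → ℝ := fun t =>
    p₀ + bp * Real.sqrt (sp t) + (q₀ + bq * Real.sqrt (sq t)) * f t with hh
  have hhc : ContinuousOn h (Set.Icc 0 T) := by
    have h1 := hspc.sqrt
    have h2 := hsqc.sqrt
    rw [hh]
    fun_prop
  have hfh : ∀ t ∈ Set.Icc (0 : ℝ) T, HasDerivAt f ((1 - f t) * h t) t := hf'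
  obtain ⟨K, hK⟩ := (isCompact_Icc (a := (0 : ℝ)) (b := T)).bddAbove_image hhc
  have hK' : ∀ t ∈ Set.Icc (0 : ℝ) T, h t ≤ K := fun t ht => hK (Set.mem_image_of_mem h ht)
  have hder : ∀ t ∈ Set.Icc (0 : ℝ) T, HasDerivAt (fun t => (1 - f t) * Real.exp (K * t))
      ((1 - f t) * (K - h t) * Real.exp (K * t)) t := by
    intro t ht
    have h1 := (hfh t ht).const_sub 1
    have h2 : HasDerivAt (fun t => Real.exp (K * t)) (Real.exp (K * t) * (K * 1)) t :=
      ((hasDerivAt_id t).const_mul K).exp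
    refine (h1.mul h2).congr_deriv ?_
    ring
  have hmono : MonotoneOn (fun t => (1 - f t) * Real.exp (K * t)) (Set.Icc 0 T) := by
    apply monotoneOn_of_deriv_nonneg (convex_Icc 0 T)
    · exact fun t ht => (hder t ht).continuousAt.continuousWithinAt
    · exact fun t ht =>
        (hder t (interior_subset ht)).differentiableAt.differentiableWithinAt
    · intro t ht
      have ht' := interior_subset ht
      rw [(hder t ht').deriv]
      have a := (hf01 t ht').2
      have b := hK' t ht'
      exact mul_nonneg (mul_nonneg (by linarith) (by linarith)) (Real.exp_pos _).le
  have hlt : ∀ t ∈ Set.Icc (0 : ℝ) T, f t < 1 := by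
    intro t ht
    have h1 := hmono ⟨le_refl 0, hT.le⟩ ht ht.1
    simp only [hf0, mul_zero, Real.exp_zero, sub_zero, mul_one] at h1
    have h2 : 0 < (1 - f t) * Real.exp (K * t) := by linarith
    have h3 := (mul_pos_iff_of_pos_right (Real.exp_pos _)).1 h2
    linarith
  have hsm : StrictMonoOn f (Set.Icc 0 T) := by
    apply strictMonoOn_of_deriv_pos (convex_Icc 0 T) hfc
    intro t ht
    have ht' := interior_subset ht
    rw [(hfh t ht').deriv]
    have a := hlt t ht'
    have b := (hf01 t ht').1
    have c : 0 < h t := by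
      have := Real.sqrt_nonneg (sp t)
      have := Real.sqrt_nonneg (sq t)
      simp only [hh]
      positivity
    exact mul_pos (by linarith) c
  have hTm : T ∈ Set.Icc (0 : ℝ) T := ⟨hT.le, le_refl T⟩
  have hfT1 := hlt T hTm
  have hfT0 : 0 < f T := hf0 ▸ hsm ⟨le_refl 0, hT.le⟩ hTm hT
  have h1f : 0 < 1 - f T := by linarith
  have e1 : sp T = bp ^ 2 * γ ^ 2 / 4 * (1 - f T) ^ 2 := by
    rw [hspdef, hΨT]; ring
  have e2 : sq T = bq ^ 2 * γ ^ 2 / 4 * (f T) ^ 2 * (1 - f T) ^ 2 := by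
    rw [hsqdef, e1]; field_simp
  refine ⟨hfT1, e1, ?_, e2, ?_⟩
  · rw [e1]; positivity
  · rw [e2]; positivity
end

section
/- Let f, Ψ : [0,∞) → ℝ be continuously differentiable with f(0) = 0 and f(t) ∈ [0,1) for all t, satisfying f′ = (1−f)(p₀ + b_p√s_p + (q₀ + b_q√s_q) f) and Ψ′ = (γe^{−θt} + Ψ)(p₀ + b_p√s_p + (q₀ + b_q√s_q)(2f−1)), where s_p(t) := (b_p²/4)((1−f)(Ψe^{θt} + γ))² and s_q(t) := (b_q²/b_p²) f² s_p. Suppose there exists t̃ ≥ 0 such that −γe^{−θt} ≤ Ψ(t) ≤ 0 for all t ≥ t̃. Then lim_{t→∞} f(t) = 1 and lim_{t→∞} s_p(t) = lim_{t→∞} s_q(t) = 0. -/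
/-- For the optimal-promotion problem on an infinite complete network with infinite planning
horizon, if the costate eventually satisfies `-γ e^{-θt} ≤ Ψ(t) ≤ 0`, then the adoption level
tends to `1` and both optimal spending rates tend to `0` as `t → ∞`. -/
theorem stmt11 (p₀ q₀ bp bq γ θ : ℝ)
    (hp₀ : 0 < p₀) (hq₀ : 0 < q₀) (hbp : 0 < bp) (hbq : 0 < bq) (hγ : 0 < γ) (hθ : 0 < θ)
    (f Ψ sp sq : ℝ → ℝ)
    (hspdef : ∀ t : ℝ, sp t =
      bp ^ 2 / 4 * ((1 - f t) * (Ψ t * Real.exp (θ * t) + γ)) ^ 2)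
    (hsqdef : ∀ t : ℝ, sq t = bq ^ 2 / bp ^ 2 * (f t) ^ 2 * sp t)
    (hf0 : f 0 = 0)
    (hf01 : ∀ t : ℝ, 0 ≤ t → f t ∈ Set.Ico (0 : ℝ) 1)
    (hf' : ∀ t : ℝ, 0 ≤ t → HasDerivAt f
      ((1 - f t) * (p₀ + bp * Real.sqrt (sp t) + (q₀ + bq * Real.sqrt (sq t)) * f t)) t)
    (hΨ' : ∀ t : ℝ, 0 ≤ t → HasDerivAt Ψ
      ((γ * Real.exp (-θ * t) + Ψ t) *
        (p₀ + bp * Real.sqrt (sp t) + (q₀ + bq * Real.sqrt (sq t)) * (2 * f t - 1))) t)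
    (hΨbound : ∃ t₀ : ℝ, 0 ≤ t₀ ∧ ∀ t : ℝ, t₀ ≤ t →
      -γ * Real.exp (-θ * t) ≤ Ψ t ∧ Ψ t ≤ 0) :
    Filter.Tendsto f Filter.atTop (nhds 1) ∧
      Filter.Tendsto sp Filter.atTop (nhds 0) ∧
      Filter.Tendsto sq Filter.atTop (nhds 0) := by
  have hg : AntitoneOn (fun t => (1 - f t) * Real.exp (p₀ * t)) (Set.Ici 0) := by
    have hd : ∀ t : ℝ, 0 ≤ t → HasDerivAt (fun t => (1 - f t) * Real.exp (p₀ * t))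
        (-((1 - f t) * (p₀ + bp * Real.sqrt (sp t) + (q₀ + bq * Real.sqrt (sq t)) * f t)) *
          Real.exp (p₀ * t) + (1 - f t) * (Real.exp (p₀ * t) * (p₀ * 1))) t := by
      intro t ht
      exact ((hf' t ht).const_sub 1).mul (((hasDerivAt_id t).const_mul p₀).exp)
    apply antitoneOn_of_deriv_nonpos (convex_Ici 0)
    · intro t ht
      exact (hd t ht).continuousAt.continuousWithinAt
    · intro t ht
      rw [interior_Ici] at ht
      exact (hd t (le_of_lt ht)).differentiableAt.differentiableWithinAt
    · intro t ht
      rw [interior_Ici] at ht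
      have ht0 : 0 ≤ t := le_of_lt ht
      rw [(hd t ht0).deriv]
      obtain ⟨h0, h1⟩ := hf01 t ht0
      have h2 : 0 ≤ (1 - f t) * Real.exp (p₀ * t) *
          (bp * Real.sqrt (sp t) + (q₀ + bq * Real.sqrt (sq t)) * f t) := by
        have : 0 ≤ 1 - f t := by linarith
        positivity
      linarith
  have hle : ∀ t : ℝ, 0 ≤ t → 1 - f t ≤ Real.exp (-(p₀ * t)) := by
    intro t ht
    have h := hg (Set.mem_Ici.2 le_rfl) (Set.mem_Ici.2 ht) ht
    simp only [hf0, mul_zero, Real.exp_zero] at h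
    rw [Real.exp_neg, ← one_div, le_div_iff₀ (Real.exp_pos _)]
    linarith
  have hexp : Filter.Tendsto (fun t : ℝ => Real.exp (-(p₀ * t))) Filter.atTop (nhds 0) :=
    Real.tendsto_exp_neg_atTop_nhds_zero.comp (Filter.tendsto_id.const_mul_atTop hp₀)
  have h1f : Filter.Tendsto (fun t => 1 - f t) Filter.atTop (nhds 0) := by
    refine tendsto_of_tendsto_of_tendsto_of_le_of_le' tendsto_const_nhds hexp ?_ ?_
    · filter_upwards [Filter.eventually_ge_atTop 0] with t ht
      linarith [(hf01 t ht).2]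
    · filter_upwards [Filter.eventually_ge_atTop 0] with t ht
      exact hle t ht
  have hf1 : Filter.Tendsto f Filter.atTop (nhds 1) := by
    simpa using h1f.const_sub 1
  obtain ⟨t₀, ht₀, hb⟩ := hΨbound
  have hsp : Filter.Tendsto sp Filter.atTop (nhds 0) := by
    have hu : Filter.Tendsto (fun t => bp ^ 2 / 4 * ((1 - f t) * γ) ^ 2) Filter.atTop
        (nhds 0) := by
      simpa using ((h1f.mul_const γ).pow 2).const_mul (bp ^ 2 / 4)
    refine tendsto_of_tendsto_of_tendsto_of_le_of_le' tendsto_const_nhds hu ?_ ?_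
    · filter_upwards with t
      rw [hspdef]
      positivity
    · filter_upwards [Filter.eventually_ge_atTop t₀] with t ht
      rw [hspdef]
      obtain ⟨ha, hc⟩ := hb t ht
      have he := Real.exp_pos (θ * t)
      have hee : Real.exp (-θ * t) * Real.exp (θ * t) = 1 := by
        rw [← Real.exp_add]; simp
      have hA : 0 ≤ Ψ t * Real.exp (θ * t) + γ := by
        have := mul_le_mul_of_nonneg_right ha he.le
        rw [mul_assoc, hee] at this
        linarith
      have hB : Ψ t * Real.exp (θ * t) + γ ≤ γ := by
        have := mul_nonpos_of_nonpos_of_nonneg hc he.le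
        linarith
      have h1 : 0 ≤ 1 - f t := by linarith [(hf01 t (ht₀.trans ht)).2]
      gcongr
  refine ⟨hf1, hsp, ?_⟩
  have := ((hf1.pow 2).const_mul (bq ^ 2 / bp ^ 2)).mul hsp
  rw [mul_zero] at this
  exact this.congr fun t => (hsqdef t).symm
end

section
/- Let 0 < T < ∞, let s_p, s_q : [0,T] → [0,∞) be continuous, and let f, y, Ψ₁, Ψ₂ : [0,T] → ℝ be continuously differentiable with f(t) ∈ [0,1] for all t, satisfying: f′ = (p₀ + b_p√s_p + (q₀ + b_q√s_q)(1 − e^{−y}))(1−f), f(0) = 0; y′ = p₀ + b_p√s_p, y(0) = 0; Ψ₁′ = (γe^{−θt} + Ψ₁)(p₀ + b_p√s_p + (q₀ + b_q√s_q)(1 − e^{−y})), Ψ₁(T) = 0; Ψ₂′ = −(γe^{−θt} + Ψ₁)(1−f)(q₀ + b_q√s_q) e^{−y}, Ψ₂(T) = 0; and the optimality relation √s_p = (b_p/2)((γ + Ψ₁e^{θt})(1−f) + Ψ₂e^{θt}). Then for all t ∈ [0,T]: −γe^{−θt} ≤ Ψ₁(t) ≤ 0 and max{0, (2√s_p(t)/b_p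 − (1−f(t))γ) e^{−θt}} ≤ Ψ₂(t) ≤ (2/b_p)√s_p(t) · e^{−θt}. -/
theorem mono_aux {T : ℝ} {g g' : ℝ → ℝ}
    (hg : ∀ t ∈ Set.Icc (0 : ℝ) T, HasDerivAt g (g' t) t)
    (hn : ∀ t ∈ Set.Icc (0 : ℝ) T, 0 ≤ g' t) : MonotoneOn g (Set.Icc 0 T) := by
  apply monotoneOn_of_deriv_nonneg (convex_Icc 0 T)
  · exact fun t ht => (hg t ht).continuousAt.continuousWithinAt
  · exact fun t ht => (hg t (interior_subset ht)).differentiableAt.differentiableWithinAt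
  · intro t ht
    rw [(hg t (interior_subset ht)).deriv]
    exact hn t (interior_subset ht)

/-- Costate bounds for the optimality boundary-value problem for promotions in the Bass
model on the infinite line: `-γ e^{-θt} ≤ Ψ₁ ≤ 0` and
`max{0, (2√s_p/b_p - (1-f)γ) e^{-θt}} ≤ Ψ₂ ≤ (2/b_p)√s_p · e^{-θt}` on `[0,T]`. -/
theorem stmt12 (p₀ q₀ bp bq γ θ : ℝ)
    (hp₀ : 0 < p₀) (hq₀ : 0 < q₀) (hbp : 0 < bp) (hbq : 0 < bq) (hγ : 0 < γ) (hθ : 0 < θ)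
    (T : ℝ) (hT : 0 < T)
    (sp sq f y Ψ₁ Ψ₂ : ℝ → ℝ)
    (hsp_cont : ContinuousOn sp (Set.Icc 0 T))
    (hsq_cont : ContinuousOn sq (Set.Icc 0 T))
    (hsp_nonneg : ∀ t ∈ Set.Icc (0 : ℝ) T, 0 ≤ sp t)
    (hsq_nonneg : ∀ t ∈ Set.Icc (0 : ℝ) T, 0 ≤ sq t)
    (hf01 : ∀ t ∈ Set.Icc (0 : ℝ) T, f t ∈ Set.Icc (0 : ℝ) 1)
    (hf0 : f 0 = 0) (hy0 : y 0 = 0) (hΨ₁T : Ψ₁ T = 0) (hΨ₂T : Ψ₂ T = 0)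
    (hf' : ∀ t ∈ Set.Icc (0 : ℝ) T, HasDerivAt f
      ((p₀ + bp * Real.sqrt (sp t)
          + (q₀ + bq * Real.sqrt (sq t)) * (1 - Real.exp (-y t))) * (1 - f t)) t)
    (hy' : ∀ t ∈ Set.Icc (0 : ℝ) T, HasDerivAt y (p₀ + bp * Real.sqrt (sp t)) t)
    (hΨ₁' : ∀ t ∈ Set.Icc (0 : ℝ) T, HasDerivAt Ψ₁
      ((γ * Real.exp (-θ * t) + Ψ₁ t) *
        (p₀ + bp * Real.sqrt (sp t)
          + (q₀ + bq * Real.sqrt (sq t)) * (1 - Real.exp (-y t)))) t)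
    (hΨ₂' : ∀ t ∈ Set.Icc (0 : ℝ) T, HasDerivAt Ψ₂
      (-((γ * Real.exp (-θ * t) + Ψ₁ t) * (1 - f t)
          * (q₀ + bq * Real.sqrt (sq t)) * Real.exp (-y t))) t)
    (hopt : ∀ t ∈ Set.Icc (0 : ℝ) T, Real.sqrt (sp t) =
      bp / 2 * ((γ + Ψ₁ t * Real.exp (θ * t)) * (1 - f t) + Ψ₂ t * Real.exp (θ * t))) :
    ∀ t ∈ Set.Icc (0 : ℝ) T,
      (-γ * Real.exp (-θ * t) ≤ Ψ₁ t ∧ Ψ₁ t ≤ 0) ∧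
      (max 0 ((2 * Real.sqrt (sp t) / bp - (1 - f t) * γ) * Real.exp (-θ * t)) ≤ Ψ₂ t ∧
        Ψ₂ t ≤ 2 / bp * Real.sqrt (sp t) * Real.exp (-θ * t)) := by
  have h0 : (0 : ℝ) ∈ Set.Icc (0 : ℝ) T := ⟨le_rfl, hT.le⟩
  have h1 : T ∈ Set.Icc (0 : ℝ) T := ⟨hT.le, le_rfl⟩
  have hy : ∀ t ∈ Set.Icc (0 : ℝ) T, 0 ≤ y t := by
    intro t ht
    have := mono_aux hy' (fun t _ => by positivity) h0 ht ht.1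
    rwa [hy0] at this
  obtain ⟨A, hA⟩ : ∃ A : ℝ → ℝ, A = fun t => p₀ + bp * Real.sqrt (sp t)
          + (q₀ + bq * Real.sqrt (sq t)) * (1 - Real.exp (-y t)) := ⟨_, rfl⟩
  have hAt : ∀ t, p₀ + bp * Real.sqrt (sp t)
          + (q₀ + bq * Real.sqrt (sq t)) * (1 - Real.exp (-y t)) = A t := by
    intro t; rw [hA]
  simp only [hAt] at hf' hΨ₁'
  have hA0 : ∀ t ∈ Set.Icc (0 : ℝ) T, 0 ≤ A t := by
    intro t ht
    have : Real.exp (-y t) ≤ 1 := Real.exp_le_one_iff.2 (by linarith [hy t ht])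
    have : 0 ≤ 1 - Real.exp (-y t) := by linarith
    rw [← hAt]; positivity
  have hAc : ContinuousOn A (Set.Icc 0 T) := by
    have hyc : ContinuousOn y (Set.Icc 0 T) :=
      fun t ht => (hy' t ht).continuousAt.continuousWithinAt
    rw [hA]; fun_prop
  obtain ⟨M, hM⟩ := isCompact_Icc.bddAbove_image hAc
  have hM' : ∀ t ∈ Set.Icc (0 : ℝ) T, A t ≤ M := fun t ht => hM ⟨t, ht, rfl⟩
  have hflt : ∀ t ∈ Set.Icc (0 : ℝ) T, 0 < 1 - f t := by
    intro t ht
    have hd : ∀ t ∈ Set.Icc (0 : ℝ) T, HasDerivAt (fun t => (1 - f t) * Real.exp (M * t))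
        ((M - A t) * (1 - f t) * Real.exp (M * t)) t := by
      intro t ht
      have := ((hf' t ht).const_sub 1).mul (((hasDerivAt_id t).const_mul M).exp)
      refine this.congr_deriv ?_
      simp only [id]; ring
    have := mono_aux hd (fun t ht => mul_nonneg (mul_nonneg (by linarith [hM' t ht])
      (by linarith [(hf01 t ht).2])) (Real.exp_pos _).le) h0 ht ht.1
    simp only [hf0, mul_zero, Real.exp_zero] at this
    exact pos_of_mul_pos_left (by linarith : 0 < (1 - f t) * Real.exp (M * t)) (Real.exp_pos _).le
  have hW : ∀ t ∈ Set.Icc (0 : ℝ) T, 0 ≤ γ * Real.exp (-θ * t) + Ψ₁ t := by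
    intro t ht
    have hd : ∀ t ∈ Set.Icc (0 : ℝ) T,
        HasDerivAt (fun t => -((γ * Real.exp (-θ * t) + Ψ₁ t) * (1 - f t)))
        (θ * γ * Real.exp (-θ * t) * (1 - f t)) t := by
      intro t ht
      have := ((((((hasDerivAt_id t).const_mul (-θ)).exp).const_mul γ).add (hΨ₁' t ht)).mul
        ((hf' t ht).const_sub 1)).neg
      refine this.congr_deriv ?_
      simp only [id, Pi.add_apply]; ring
    have := mono_aux hd (fun t ht => by have := hflt t ht; positivity) ht h1 ht.2
    simp only [hΨ₁T] at this
    have h2 := hflt T h1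
    have h3 : 0 ≤ (γ * Real.exp (-θ * T) + 0) * (1 - f T) := by positivity
    exact nonneg_of_mul_nonneg_left (by linarith :
      0 ≤ (γ * Real.exp (-θ * t) + Ψ₁ t) * (1 - f t)) (hflt t ht)
  intro t ht
  have hP1 : Ψ₁ t ≤ 0 := by
    have := mono_aux hΨ₁' (fun t ht => mul_nonneg (hW t ht) (hA0 t ht)) ht h1 ht.2
    rwa [hΨ₁T] at this
  have hP2 : 0 ≤ Ψ₂ t := by
    have := mono_aux (fun t ht => (hΨ₂' t ht).neg) (fun t ht => by
      have h1 := hW t ht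
      have h2 := hflt t ht
      rw [neg_neg]
      positivity) ht h1 ht.2
    simp only [Pi.neg_apply, hΨ₂T] at this
    linarith
  have hE : Real.exp (θ * t) * Real.exp (-θ * t) = 1 := by
    rw [← Real.exp_add]; simp
  have hk : 2 / bp * Real.sqrt (sp t) * Real.exp (-θ * t)
      = (γ * Real.exp (-θ * t) + Ψ₁ t) * (1 - f t) + Ψ₂ t := by
    rw [hopt t ht]
    generalize Real.exp (-θ * t) = e at hE ⊢
    field_simp
    linear_combination (Ψ₁ t * (1 - f t) + Ψ₂ t) * hE
  have hk2 : (2 * Real.sqrt (sp t) / bp - (1 - f t) * γ) * Real.exp (-θ * t)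
      = Ψ₁ t * (1 - f t) + Ψ₂ t := by
    linear_combination hk
  have hw := hW t ht
  have hl := hflt t ht
  refine ⟨⟨by linarith, hP1⟩, max_le hP2 ?_, ?_⟩
  · rw [hk2]; nlinarith
  · rw [hk]; nlinarith
end

section
/- Let f, y, Ψ₁, Ψ₂ : [0,∞) → ℝ be continuously differentiable with f(t) ∈ [0,1) for all t, satisfying the infinite-line optimality system: f′ = (p₀ + b_p√s_p + (q₀ + b_q√s_q)(1 − e^{−y}))(1−f), f(0) = 0; y′ = p₀ + b_p√s_p, y(0) = 0; Ψ₁′ = (γe^{−θt} + Ψ₁)(p₀ + b_p√s_p + (q₀ + b_q√s_q)(1 − e^{−y})); Ψ₂′ = −(γe^{−θt} + Ψ₁)(1−f)(q₀ + b_q√s_q)e^{−y}; where s_p := (b_p²/4)((γ + Ψ₁e^{θt})(1−f) + Ψ₂e^{θt})² and s_q := (b_q²/4)((γ + Ψ₁e^{θt})(1−f)(1 − e^{−y}))². Suppose that for all t ≥ 0, −γe^{−θt} ≤ Ψ₁(t) ≤ 0 and 0 ≤ Ψ₂(t) ≤ (2/b_p)√s_p(t) · e^{−θt}, and that Ψ₂(t)e^{θt}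 → 0 as t → ∞. Then lim_{t→∞} f(t) = 1 and lim_{t→∞} s_p(t) = lim_{t→∞} s_q(t) = 0. -/
/-- For the infinite-line optimality system with infinite planning horizon, if the costates
satisfy `-γ e^{-θt} ≤ Ψ₁ ≤ 0` and `0 ≤ Ψ₂ ≤ (2/b_p)√s_p · e^{-θt}` and `Ψ₂ e^{θt} → 0`,
then the adoption level tends to `1` and both optimal spending rates tend to `0`. -/
theorem stmt14 (p₀ q₀ bp bq γ θ : ℝ)
    (hp₀ : 0 < p₀) (hq₀ : 0 < q₀) (hbp : 0 < bp) (hbq : 0 < bq) (hγ : 0 < γ) (hθ : 0 < θ)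
    (f y Ψ₁ Ψ₂ sp sq : ℝ → ℝ)
    (hspdef : ∀ t : ℝ, sp t = bp ^ 2 / 4 *
      ((γ + Ψ₁ t * Real.exp (θ * t)) * (1 - f t) + Ψ₂ t * Real.exp (θ * t)) ^ 2)
    (hsqdef : ∀ t : ℝ, sq t = bq ^ 2 / 4 *
      ((γ + Ψ₁ t * Real.exp (θ * t)) * (1 - f t) * (1 - Real.exp (-y t))) ^ 2)
    (hf01 : ∀ t : ℝ, 0 ≤ t → f t ∈ Set.Ico (0 : ℝ) 1)
    (hf0 : f 0 = 0) (hy0 : y 0 = 0)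
    (hf' : ∀ t : ℝ, 0 ≤ t → HasDerivAt f
      ((p₀ + bp * Real.sqrt (sp t)
          + (q₀ + bq * Real.sqrt (sq t)) * (1 - Real.exp (-y t))) * (1 - f t)) t)
    (hy' : ∀ t : ℝ, 0 ≤ t → HasDerivAt y (p₀ + bp * Real.sqrt (sp t)) t)
    (hΨ₁' : ∀ t : ℝ, 0 ≤ t → HasDerivAt Ψ₁
      ((γ * Real.exp (-θ * t) + Ψ₁ t) *
        (p₀ + bp * Real.sqrt (sp t)
          + (q₀ + bq * Real.sqrt (sq t)) * (1 - Real.exp (-y t)))) t)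
    (hΨ₂' : ∀ t : ℝ, 0 ≤ t → HasDerivAt Ψ₂
      (-((γ * Real.exp (-θ * t) + Ψ₁ t) * (1 - f t)
          * (q₀ + bq * Real.sqrt (sq t)) * Real.exp (-y t))) t)
    (hΨ₁bound : ∀ t : ℝ, 0 ≤ t → -γ * Real.exp (-θ * t) ≤ Ψ₁ t ∧ Ψ₁ t ≤ 0)
    (hΨ₂bound : ∀ t : ℝ, 0 ≤ t →
      0 ≤ Ψ₂ t ∧ Ψ₂ t ≤ 2 / bp * Real.sqrt (sp t) * Real.exp (-θ * t))
    (hΨ₂lim : Filter.Tendsto (fun t => Ψ₂ t * Real.exp (θ * t)) Filter.atTop (nhds 0)) :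
    Filter.Tendsto f Filter.atTop (nhds 1) ∧
      Filter.Tendsto sp Filter.atTop (nhds 0) ∧
      Filter.Tendsto sq Filter.atTop (nhds 0) := by
  have hyn : ∀ t : ℝ, 0 ≤ t → 0 ≤ y t := by
    have hm : MonotoneOn y (Set.Ici 0) := by
      apply monotoneOn_of_deriv_nonneg (convex_Ici 0)
      · exact fun t ht => (hy' t ht).continuousAt.continuousWithinAt
      · intro t ht
        rw [interior_Ici] at ht
        exact (hy' t (le_of_lt ht)).differentiableAt.differentiableWithinAt
      · intro t ht
        rw [interior_Ici] at ht
        rw [(hy' t (le_of_lt ht)).deriv]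
        positivity
    intro t ht
    have := hm (Set.mem_Ici.2 le_rfl) (Set.mem_Ici.2 ht) ht
    rwa [hy0] at this
  have hE : ∀ t : ℝ, 0 ≤ t → 0 ≤ 1 - Real.exp (-y t) := by
    intro t ht
    have := hyn t ht
    have : Real.exp (-y t) ≤ 1 := Real.exp_le_one_iff.2 (by linarith)
    linarith
  have hg' : ∀ t : ℝ, 0 ≤ t → HasDerivAt (fun t => (1 - f t) * Real.exp (p₀ * t))
      (-((p₀ + bp * Real.sqrt (sp t)
          + (q₀ + bq * Real.sqrt (sq t)) * (1 - Real.exp (-y t))) * (1 - f t)) *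
          Real.exp (p₀ * t) + (1 - f t) * (Real.exp (p₀ * t) * p₀)) t := by
    intro t ht
    have h2 : HasDerivAt (fun t : ℝ => p₀ * t) p₀ t := by
      simpa using (hasDerivAt_id t).const_mul p₀
    exact ((hf' t ht).const_sub 1).mul h2.exp
  have hfb : ∀ t : ℝ, 0 ≤ t → 1 - f t ≤ Real.exp (-(p₀ * t)) := by
    have hm : AntitoneOn (fun t => (1 - f t) * Real.exp (p₀ * t)) (Set.Ici 0) := by
      apply antitoneOn_of_deriv_nonpos (convex_Ici 0)
      · exact fun t ht => (hg' t ht).continuousAt.continuousWithinAt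
      · intro t ht
        rw [interior_Ici] at ht
        exact (hg' t (le_of_lt ht)).differentiableAt.differentiableWithinAt
      · intro t ht
        rw [interior_Ici] at ht
        have ht0 : 0 ≤ t := le_of_lt ht
        rw [(hg' t ht0).deriv]
        have h1 : 0 ≤ 1 - f t := by linarith [(hf01 t ht0).2]
        have h2 := hE t ht0
        have h3 : 0 ≤ (bp * Real.sqrt (sp t)
          + (q₀ + bq * Real.sqrt (sq t)) * (1 - Real.exp (-y t))) * (1 - f t) *
            Real.exp (p₀ * t) := by positivity
        linarith
    intro t ht
    have := hm (Set.mem_Ici.2 le_rfl) (Set.mem_Ici.2 ht) ht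
    simp only [hf0, mul_zero, Real.exp_zero, sub_zero, mul_one] at this
    rw [Real.exp_neg, ← one_div, le_div_iff₀ (Real.exp_pos _)]
    exact this
  have hexp : Filter.Tendsto (fun t : ℝ => Real.exp (-(p₀ * t))) Filter.atTop (nhds 0) :=
    Real.tendsto_exp_neg_atTop_nhds_zero.comp (Filter.tendsto_id.const_mul_atTop hp₀)
  have h1f : Filter.Tendsto (fun t => 1 - f t) Filter.atTop (nhds 0) := by
    refine squeeze_zero' ?_ ?_ hexp
    · filter_upwards [Filter.eventually_ge_atTop 0] with t ht
      linarith [(hf01 t ht).2]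
    · filter_upwards [Filter.eventually_ge_atTop 0] with t ht using hfb t ht
  have hA : ∀ t : ℝ, 0 ≤ t → 0 ≤ γ + Ψ₁ t * Real.exp (θ * t) ∧
      γ + Ψ₁ t * Real.exp (θ * t) ≤ γ := by
    intro t ht
    obtain ⟨ha, hb⟩ := hΨ₁bound t ht
    have he := Real.exp_pos (θ * t)
    have h1 := mul_le_mul_of_nonneg_right ha he.le
    have h2 : Real.exp (-θ * t) * Real.exp (θ * t) = 1 := by
      rw [← Real.exp_add]; simp
    rw [mul_assoc, h2] at h1
    have h3 := mul_nonpos_of_nonpos_of_nonneg hb he.le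
    constructor <;> linarith
  have hB : Filter.Tendsto (fun t => (γ + Ψ₁ t * Real.exp (θ * t)) * (1 - f t))
      Filter.atTop (nhds 0) := by
    have h0 : Filter.Tendsto (fun t => γ * (1 - f t)) Filter.atTop (nhds 0) := by
      simpa using h1f.const_mul γ
    refine squeeze_zero' ?_ ?_ h0
    · filter_upwards [Filter.eventually_ge_atTop 0] with t ht
      exact mul_nonneg (hA t ht).1 (by linarith [(hf01 t ht).2])
    · filter_upwards [Filter.eventually_ge_atTop 0] with t ht
      exact mul_le_mul_of_nonneg_right (hA t ht).2 (by linarith [(hf01 t ht).2])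
  have hC : Filter.Tendsto (fun t => (γ + Ψ₁ t * Real.exp (θ * t)) * (1 - f t) *
      (1 - Real.exp (-y t))) Filter.atTop (nhds 0) := by
    refine squeeze_zero' ?_ ?_ hB
    · filter_upwards [Filter.eventually_ge_atTop 0] with t ht
      exact mul_nonneg (mul_nonneg (hA t ht).1 (by linarith [(hf01 t ht).2])) (hE t ht)
    · filter_upwards [Filter.eventually_ge_atTop 0] with t ht
      exact mul_le_of_le_one_right
        (mul_nonneg (hA t ht).1 (by linarith [(hf01 t ht).2]))
        (by linarith [Real.exp_pos (-y t)])
  refine ⟨?_, ?_, ?_⟩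
  · simpa using h1f.const_sub 1
  · rw [funext hspdef]
    simpa using ((hB.add hΨ₂lim).pow 2).const_mul (bp ^ 2 / 4)
  · rw [funext hsqdef]
    simpa using (hC.pow 2).const_mul (bq ^ 2 / 4)
end

section
/- Let T ∈ (0,∞], suppose both groups have identical parameters p₀¹ = p₀² = p₀, q₀¹ = q₀² = q₀, b_{p¹} = b_{p²} = b_p, b_{q¹} = b_{q²} = b_q, and let f, Ψ : [0,T) → ℝ with f ∈ [0,1) solve the homogeneous infinite-complete optimality system: f′ = (1−f)(p₀ + b_p√s_p + (q₀ + b_q√s_q) f), f(0) = 0; Ψ′ = (γe^{−θt} + Ψ)(p₀ + b_p√s_p + (q₀ + b_q√s_q)(2f−1)); with s_p = (b_p²/4)((1−f)(Ψe^{θt} + γ))² and s_q = (b_q²/b_p²) f² s_p. Then f₁ := f/2, f₂ := f/2, Ψ₁ := Ψ, Ψ₂ := Ψ, s_{p¹} = s_{p²} := s_p, s_{q¹} = s_{q²} := s_q solve the two-group optimality system: f_k′ = (1/2 − f_k)(p₀ + b_p√s_{pk} + (q₀ + b_q√s_{qk})(f₁+f₂)), f_k(0) = 0; Ψ₁′ =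 (γe^{−θt} + Ψ₁)(R₁ − (1/2 − f₁)(q₀ + b_q√s_{q¹})) − (γe^{−θt} + Ψ₂)(1/2 − f₂)(q₀ + b_q√s_{q²}) with R_k := p₀ + b_p√s_{pk} + (q₀ + b_q√s_{qk})(f₁+f₂), similarly for Ψ₂′; together with the group optimality relations s_{pk} = (b_p(1/2 − f_k)(γ + Ψ_k e^{θt}))² and s_{qk} = ((f₁+f₂) b_q (1/2 − f_k)(γ + Ψ_k e^{θt}))². -/
/-- When the two groups have identical parameters, the symmetric splitting
`f₁ = f₂ = f/2`, `Ψ₁ = Ψ₂ = Ψ`, `s_{p¹} = s_{p²} = s_p`, `s_{q¹} = s_{q²} = s_q` of the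
homogeneous infinite-complete optimality solution solves the two-group (heterogeneous
promotion) optimality system, including the group optimality relations. -/
theorem stmt16 (p₀ q₀ bp bq γ θ : ℝ)
    (hp₀ : 0 < p₀) (hq₀ : 0 < q₀) (hbp : 0 < bp) (hbq : 0 < bq) (hγ : 0 < γ) (hθ : 0 < θ)
    (T : EReal) (hT : 0 < T)
    (f Ψ sp sq : ℝ → ℝ)
    (hspdef : ∀ t : ℝ, sp t =
      bp ^ 2 / 4 * ((1 - f t) * (Ψ t * Real.exp (θ * t) + γ)) ^ 2)
    (hsqdef : ∀ t : ℝ, sq t = bq ^ 2 / bp ^ 2 * (f t) ^ 2 * sp t)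
    (hf01 : ∀ t : ℝ, 0 ≤ t → (t : EReal) < T → f t ∈ Set.Ico (0 : ℝ) 1)
    (hf0 : f 0 = 0)
    (hf' : ∀ t : ℝ, 0 ≤ t → (t : EReal) < T → HasDerivAt f
      ((1 - f t) * (p₀ + bp * Real.sqrt (sp t) + (q₀ + bq * Real.sqrt (sq t)) * f t)) t)
    (hΨ' : ∀ t : ℝ, 0 ≤ t → (t : EReal) < T → HasDerivAt Ψ
      ((γ * Real.exp (-θ * t) + Ψ t) *
        (p₀ + bp * Real.sqrt (sp t) + (q₀ + bq * Real.sqrt (sq t)) * (2 * f t - 1))) t)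
    (f₁ f₂ Ψ₁ Ψ₂ sp₁ sp₂ sq₁ sq₂ : ℝ → ℝ)
    (hf₁ : f₁ = fun t => f t / 2) (hf₂ : f₂ = fun t => f t / 2)
    (hΨ₁ : Ψ₁ = Ψ) (hΨ₂ : Ψ₂ = Ψ)
    (hsp₁ : sp₁ = sp) (hsp₂ : sp₂ = sp) (hsq₁ : sq₁ = sq) (hsq₂ : sq₂ = sq) :
    f₁ 0 = 0 ∧ f₂ 0 = 0 ∧
    (∀ t : ℝ, 0 ≤ t → (t : EReal) < T →
      -- group state equations
      (HasDerivAt f₁ ((1 / 2 - f₁ t) *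
          (p₀ + bp * Real.sqrt (sp₁ t)
            + (q₀ + bq * Real.sqrt (sq₁ t)) * (f₁ t + f₂ t))) t ∧
        HasDerivAt f₂ ((1 / 2 - f₂ t) *
          (p₀ + bp * Real.sqrt (sp₂ t)
            + (q₀ + bq * Real.sqrt (sq₂ t)) * (f₁ t + f₂ t))) t) ∧
      -- group costate equations
      (HasDerivAt Ψ₁
          ((γ * Real.exp (-θ * t) + Ψ₁ t) *
              ((p₀ + bp * Real.sqrt (sp₁ t)
                  + (q₀ + bq * Real.sqrt (sq₁ t)) * (f₁ t + f₂ t))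
                - (1 / 2 - f₁ t) * (q₀ + bq * Real.sqrt (sq₁ t)))
            - (γ * Real.exp (-θ * t) + Ψ₂ t) *
                (1 / 2 - f₂ t) * (q₀ + bq * Real.sqrt (sq₂ t))) t ∧
        HasDerivAt Ψ₂
          ((γ * Real.exp (-θ * t) + Ψ₂ t) *
              ((p₀ + bp * Real.sqrt (sp₂ t)
                  + (q₀ + bq * Real.sqrt (sq₂ t)) * (f₁ t + f₂ t))
                - (1 / 2 - f₂ t) * (q₀ + bq * Real.sqrt (sq₂ t)))
            - (γ * Real.exp (-θ * t) + Ψ₁ t) *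
                (1 / 2 - f₁ t) * (q₀ + bq * Real.sqrt (sq₁ t))) t) ∧
      -- group optimality relations
      (sp₁ t = (bp * (1 / 2 - f₁ t) * (γ + Ψ₁ t * Real.exp (θ * t))) ^ 2 ∧
        sp₂ t = (bp * (1 / 2 - f₂ t) * (γ + Ψ₂ t * Real.exp (θ * t))) ^ 2 ∧
        sq₁ t = ((f₁ t + f₂ t) * bq * (1 / 2 - f₁ t)
            * (γ + Ψ₁ t * Real.exp (θ * t))) ^ 2 ∧
        sq₂ t = ((f₁ t + f₂ t) * bq * (1 / 2 - f₂ t)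
            * (γ + Ψ₂ t * Real.exp (θ * t))) ^ 2)) := by
  subst hf₁ hf₂ hΨ₁ hΨ₂ hsp₁ hsp₂ hsq₁ hsq₂
  refine ⟨by simp [hf0], by simp [hf0], fun t ht htT => ?_⟩
  have hne : bp ≠ 0 := hbp.ne'
  have h1 := (hf' t ht htT).div_const 2
  have h2 := hΨ' t ht htT
  refine ⟨⟨?_, ?_⟩, ⟨?_, ?_⟩, ?_, ?_, ?_, ?_⟩
  · refine h1.congr_deriv ?_
    ring
  · refine h1.congr_deriv ?_
    ring
  · refine h2.congr_deriv ?_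
    ring
  · refine h2.congr_deriv ?_
    ring
  · rw [hspdef]
    ring
  · rw [hspdef]
    ring
  · rw [hsqdef, hspdef]
    field_simp
    ring
  · rw [hsqdef, hspdef]
    field_simp
    ring
end

section
/- Fix t ≥ 0, f₁, f₂ ∈ [0,1/2) with f₁ + f₂ > 0, and Ψ₁, Ψ₂ ∈ ℝ with γ + Ψ_k e^{θt} > 0 for k = 1, 2. Define H : (0,∞)⁴ → ℝ by H(s_{p¹}, s_{p²}, s_{q¹}, s_{q²}) = Σ_{k=1}² (γe^{−θt} + Ψ_k)(1/2 − f_k)(p₀^k + b_{pk}√s_{pk} + (q₀^k + b_{qk}√s_{qk})(f₁+f₂)) − (1/2)(s_{p¹} + s_{p²} + s_{q¹} + s_{q²})e^{−θt}. Then all four partial derivatives of H vanish at (s_{p¹}, s_{p²}, s_{q¹}, s_{q²}) ∈ (0,∞)⁴ if and only if s_{pk} = (b_{pk}(1/2 − f_k)(γ + Ψ_k e^{θt}))² and s_{qk} = ((f₁+f₂) b_{qk} (1/2 − f_k)(γ + Ψ_k e^{θt}))² for k = 1, 2. -/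
theorem crit_aux (g : ℝ → ℝ) (E A C s : ℝ) (hE : 0 < E) (hA : 0 < A) (hs : 0 < s)
    (hg : ∀ x, g x = E * A * Real.sqrt x - 1 / 2 * E * x + C) :
    deriv g s = 0 ↔ s = A ^ 2 := by
  have hr : 0 < Real.sqrt s := Real.sqrt_pos.2 hs
  have h1 : HasDerivAt g (E * A * (1 / (2 * Real.sqrt s)) - 1 / 2 * E * 1) s := by
    have : g = fun x => E * A * Real.sqrt x - 1 / 2 * E * x + C := funext hg
    rw [this]
    exact (((Real.hasDerivAt_sqrt hs.ne').const_mul (E * A)).sub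
      ((hasDerivAt_id s).const_mul (1 / 2 * E))).add_const C
  rw [h1.deriv]
  have h2 : E * A * (1 / (2 * Real.sqrt s)) - 1 / 2 * E * 1
      = E / (2 * Real.sqrt s) * (A - Real.sqrt s) := by
    field_simp
  have h3 : E / (2 * Real.sqrt s) ≠ 0 := by positivity
  rw [h2, mul_eq_zero, or_iff_right h3, sub_eq_zero, eq_comm,
    Real.sqrt_eq_iff_eq_sq hs.le hA.le]

/-- First-order optimality condition for the Hamiltonian of the optimal-promotion problem
on an infinite heterogeneous complete network of two equal-size homogeneous groups, where
each group receives its own promotion `(s_{pk}, s_{qk})`, with square-root promotion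
response `p_k(s) = p₀^k + b_{pk} √s`, `q_k(s) = q₀^k + b_{qk} √s`. -/
theorem stmt17 (p₁ p₂ q₁ q₂ bp₁ bp₂ bq₁ bq₂ γ θ : ℝ)
    (hp₁ : 0 < p₁) (hp₂ : 0 < p₂) (hq₁ : 0 < q₁) (hq₂ : 0 < q₂)
    (hbp₁ : 0 < bp₁) (hbp₂ : 0 < bp₂) (hbq₁ : 0 < bq₁) (hbq₂ : 0 < bq₂)
    (hγ : 0 < γ) (hθ : 0 < θ)
    (t f₁ f₂ Ψ₁ Ψ₂ : ℝ) (ht : 0 ≤ t)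
    (hf₁ : f₁ ∈ Set.Ico (0 : ℝ) (1 / 2)) (hf₂ : f₂ ∈ Set.Ico (0 : ℝ) (1 / 2))
    (hfsum : 0 < f₁ + f₂)
    (hΨ₁ : 0 < γ + Ψ₁ * Real.exp (θ * t)) (hΨ₂ : 0 < γ + Ψ₂ * Real.exp (θ * t))
    (H : ℝ → ℝ → ℝ → ℝ → ℝ)
    (hH : ∀ sp₁ sp₂ sq₁ sq₂ : ℝ, H sp₁ sp₂ sq₁ sq₂ =
      (γ * Real.exp (-θ * t) + Ψ₁) * (1 / 2 - f₁) *
          (p₁ + bp₁ * Real.sqrt sp₁ + (q₁ + bq₁ * Real.sqrt sq₁) * (f₁ + f₂))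
        + (γ * Real.exp (-θ * t) + Ψ₂) * (1 / 2 - f₂) *
            (p₂ + bp₂ * Real.sqrt sp₂ + (q₂ + bq₂ * Real.sqrt sq₂) * (f₁ + f₂))
        - 1 / 2 * (sp₁ + sp₂ + sq₁ + sq₂) * Real.exp (-θ * t))
    (sp₁ sp₂ sq₁ sq₂ : ℝ)
    (hsp₁ : 0 < sp₁) (hsp₂ : 0 < sp₂) (hsq₁ : 0 < sq₁) (hsq₂ : 0 < sq₂) :
    (deriv (fun s => H s sp₂ sq₁ sq₂) sp₁ = 0 ∧
      deriv (fun s => H sp₁ s sq₁ sq₂) sp₂ = 0 ∧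
      deriv (fun s => H sp₁ sp₂ s sq₂) sq₁ = 0 ∧
      deriv (fun s => H sp₁ sp₂ sq₁ s) sq₂ = 0) ↔
      (sp₁ = (bp₁ * (1 / 2 - f₁) * (γ + Ψ₁ * Real.exp (θ * t))) ^ 2 ∧
        sp₂ = (bp₂ * (1 / 2 - f₂) * (γ + Ψ₂ * Real.exp (θ * t))) ^ 2 ∧
        sq₁ = ((f₁ + f₂) * bq₁ * (1 / 2 - f₁) * (γ + Ψ₁ * Real.exp (θ * t))) ^ 2 ∧
        sq₂ = ((f₁ + f₂) * bq₂ * (1 / 2 - f₂) * (γ + Ψ₂ * Real.exp (θ * t))) ^ 2) := by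
  have hE : 0 < Real.exp (-θ * t) := Real.exp_pos _
  have hEE : Real.exp (-θ * t) * Real.exp (θ * t) = 1 := by
    rw [← Real.exp_add]; simp
  have e : ∀ Ψ : ℝ, γ * Real.exp (-θ * t) + Ψ
      = Real.exp (-θ * t) * (γ + Ψ * Real.exp (θ * t)) := fun Ψ => by
    linear_combination (-Ψ) * hEE
  simp only [e] at hH
  have g₁ : 0 < 1 / 2 - f₁ := sub_pos.2 hf₁.2
  have g₂ : 0 < 1 / 2 - f₂ := sub_pos.2 hf₂.2
  generalize Real.exp (-θ * t) = E at *
  generalize γ + Ψ₁ * Real.exp (θ * t) = A₁ at *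
  generalize γ + Ψ₂ * Real.exp (θ * t) = A₂ at *
  have k0 := crit_aux (fun s => H s sp₂ sq₁ sq₂) E (bp₁ * (1 / 2 - f₁) * A₁) (H 0 sp₂ sq₁ sq₂) sp₁ hE
    (by positivity) (by assumption) (fun x => by simp only [hH, Real.sqrt_zero]; ring)
  have k1 := crit_aux (fun s => H sp₁ s sq₁ sq₂) E (bp₂ * (1 / 2 - f₂) * A₂) (H sp₁ 0 sq₁ sq₂) sp₂ hE
    (by positivity) (by assumption) (fun x => by simp only [hH, Real.sqrt_zero]; ring)
  have k2 := crit_aux (fun s => H sp₁ sp₂ s sq₂) E ((f₁ + f₂) * bq₁ * (1 / 2 - f₁) * A₁) (H sp₁ sp₂ 0 sq₂) sq₁ hE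
    (by positivity) (by assumption) (fun x => by simp only [hH, Real.sqrt_zero]; ring)
  have k3 := crit_aux (fun s => H sp₁ sp₂ sq₁ s) E ((f₁ + f₂) * bq₂ * (1 / 2 - f₂) * A₂) (H sp₁ sp₂ sq₁ 0) sq₂ hE
    (by positivity) (by assumption) (fun x => by simp only [hH, Real.sqrt_zero]; ring)
  rw [k0, k1, k2, k3]
end
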